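/- Let r ≥ 0, T > 0, σ_Y > 0 and γ° > 0. Then there exists exactly one pair (β3, γ) of C¹ real-valued functions on [0,T] satisfying the boundary value problem β3'(t) = β3(t)·[r(2β3(t) − 1) − (1 − β3(t))·β3(t)·γ(t)/σ_Y²] with β3(T) = 1/2, and γ'(t) = −γ(t)²·β3(t)²/σ_Y² with γ(0) = γ°. Moreover this solution satisfies: β3(t) ∈ (1/2, 1) for every t ∈ [0,T); β3 is strictly decreasing on [0,T]; and γ(t) > 0 for all t, with γ strictly decreasing on [0,T]. -/

import Mathlib

open Set

/-- A pair `(β3, γ)` solving the boundary value problem characterizing the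
linear Markov equilibrium of the leadership game with perfect feedback. -/
def PubSol (r T σY γo : ℝ) (β3 γ : ℝ → ℝ) : Prop :=
  ContDiffOn ℝ 1 β3 (Icc 0 T) ∧ ContDiffOn ℝ 1 γ (Icc 0 T) ∧
  (∀ t ∈ Icc (0:ℝ) T,
    HasDerivWithinAt β3
      (β3 t * (r * (2 * β3 t - 1) - (1 - β3 t) * β3 t * γ t / σY^2)) (Icc 0 T) t) ∧
  (∀ t ∈ Icc (0:ℝ) T,
    HasDerivWithinAt γ (-(γ t)^2 * (β3 t)^2 / σY^2) (Icc 0 T) t) ∧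
  β3 T = 1/2 ∧ γ 0 = γo

section Comparison

variable {a y dy : ℝ → ℝ} {T : ℝ}

/-- Integrating factor for the differential inequality `a * y ≤ dy`. -/
theorem exists_pos_monotoneOn_mul (hT : 0 ≤ T) (ha : ContinuousOn a (Icc 0 T))
    (hy : ∀ t ∈ Icc 0 T, HasDerivWithinAt y (dy t) (Icc 0 T) t)
    (h : ∀ t ∈ Icc 0 T, a t * y t ≤ dy t) :
    ∃ E : ℝ → ℝ, (∀ t, 0 < E t) ∧ MonotoneOn (fun t => y t * E t) (Icc 0 T) := by
  set aExt : ℝ → ℝ := IccExtend hT ((Icc 0 T).domRestrict a) with haExt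
  have hc : Continuous aExt := ha.domRestrict.Icc_extend'
  have heq : ∀ t ∈ Icc 0 T, aExt t = a t := fun t ht => by
    rw [haExt, IccExtend_of_mem _ _ ht, domRestrict_apply]
  have hA : ∀ t, HasDerivAt (fun u => ∫ x in (0:ℝ)..u, aExt x) (aExt t) t := fun t =>
    hc.integral_hasStrictDerivAt 0 t |>.hasDerivAt
  have hd : ∀ t ∈ Icc 0 T, HasDerivWithinAt
      (fun t => y t * Real.exp (-∫ x in (0:ℝ)..t, aExt x))
      ((dy t - a t * y t) * Real.exp (-∫ x in (0:ℝ)..t, aExt x)) (Icc 0 T) t := fun t ht => by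
    refine ((hy t ht).fun_mul (hA t).fun_neg.exp.hasDerivWithinAt).congr_deriv ?_
    rw [heq t ht]
    ring
  refine ⟨fun t => Real.exp (-∫ x in (0:ℝ)..t, aExt x), fun t => Real.exp_pos _,
    monotoneOn_of_hasDerivWithinAt_nonneg (convex_Icc 0 T)
      (fun t ht => (hd t ht).continuousWithinAt)
      (fun t ht => (hd t (interior_subset ht)).mono interior_subset) fun t ht => ?_⟩
  exact mul_nonneg (sub_nonneg.2 (h t (interior_subset ht))) (Real.exp_pos _).le

theorem pos_of_pos_left (ha : ContinuousOn a (Icc 0 T))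
    (hy : ∀ t ∈ Icc 0 T, HasDerivWithinAt y (dy t) (Icc 0 T) t)
    (h : ∀ t ∈ Icc 0 T, a t * y t ≤ dy t) (h0 : 0 < y 0) {t : ℝ} (ht : t ∈ Icc 0 T) :
    0 < y t := by
  have hT : 0 ≤ T := ht.1.trans ht.2
  obtain ⟨E, hE, hm⟩ := exists_pos_monotoneOn_mul hT ha hy h
  exact pos_of_mul_pos_left
    ((mul_pos h0 (hE 0)).trans_le (hm (left_mem_Icc.2 hT) ht ht.1)) (hE t).le

theorem neg_of_neg_right (ha : ContinuousOn a (Icc 0 T))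
    (hy : ∀ t ∈ Icc 0 T, HasDerivWithinAt y (dy t) (Icc 0 T) t)
    (h : ∀ t ∈ Icc 0 T, a t * y t ≤ dy t) (h0 : y T < 0) {t : ℝ} (ht : t ∈ Icc 0 T) :
    y t < 0 := by
  have hT : 0 ≤ T := ht.1.trans ht.2
  obtain ⟨E, hE, hm⟩ := exists_pos_monotoneOn_mul hT ha hy h
  exact neg_of_mul_neg_left
    ((hm ht (right_mem_Icc.2 hT) ht.2).trans_lt (mul_neg_of_neg_of_pos h0 (hE T))) (hE t).le

/-- If `y` is nonnegative initially and nondecreasing wherever it is negative, it stays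
nonnegative. -/
theorem nonneg_of_nonneg_left (hy : ∀ t ∈ Icc 0 T, HasDerivWithinAt y (dy t) (Icc 0 T) t)
    (h : ∀ t ∈ Icc 0 T, y t < 0 → 0 ≤ dy t) (h0 : 0 ≤ y 0) {t : ℝ} (ht : t ∈ Icc 0 T) :
    0 ≤ y t := by
  by_contra! hneg
  have hsub : Icc 0 t ⊆ Icc 0 T := Icc_subset_Icc_right ht.2
  have hcont : ContinuousOn y (Icc 0 t) := fun s hs =>
    (hy s (hsub hs)).continuousWithinAt.mono hsub
  have hcomp : IsCompact (Icc 0 t ∩ y ⁻¹' Ici 0) :=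
    isCompact_Icc.of_isClosed_subset (hcont.preimage_isClosed_of_isClosed isClosed_Icc isClosed_Ici)
      inter_subset_left
  obtain ⟨s, ⟨hs, hys⟩, hmax⟩ := hcomp.exists_isGreatest ⟨0, left_mem_Icc.2 ht.1, h0⟩
  have hsub' : Icc s t ⊆ Icc 0 t := Icc_subset_Icc_left hs.1
  have hm : MonotoneOn y (Icc s t) := by
    refine monotoneOn_of_hasDerivWithinAt_nonneg (f' := dy) (convex_Icc s t) (hcont.mono hsub')
      (fun u hu => (hy u (hsub (hsub' (interior_subset hu)))).mono
        (interior_subset.trans (hsub'.trans hsub))) fun u hu => ?_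
    rw [interior_Icc] at hu
    have hu' : u ∈ Icc 0 t := hsub' (Ioo_subset_Icc_self hu)
    exact h u (hsub hu') (not_le.1 fun hu0 => (hmax ⟨hu', hu0⟩).not_gt hu.1)
  have := hm (left_mem_Icc.2 hs.2) (right_mem_Icc.2 hs.2) hs.2
  exact (hys.trans this).not_gt hneg

/-- If `y` is nonnegative finally and nonincreasing wherever it is negative, it was always
nonnegative. -/
theorem nonneg_of_nonneg_right (hy : ∀ t ∈ Icc 0 T, HasDerivWithinAt y (dy t) (Icc 0 T) t)
    (h : ∀ t ∈ Icc 0 T, y t < 0 → dy t ≤ 0) (h0 : 0 ≤ y T) {t : ℝ} (ht : t ∈ Icc 0 T) :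
    0 ≤ y t := by
  have hmaps : MapsTo (fun s => T - s) (Icc 0 T) (Icc 0 T) := fun s hs =>
    ⟨sub_nonneg.2 hs.2, sub_le_self _ hs.1⟩
  have hd : ∀ s ∈ Icc 0 T, HasDerivWithinAt (fun s => y (T - s)) (-dy (T - s)) (Icc 0 T) s :=
    fun s hs => by
      refine ((hy (T - s) (hmaps hs)).scomp s
        ((hasDerivAt_id s).const_sub T).hasDerivWithinAt hmaps).congr_deriv ?_
      simp
  simpa using nonneg_of_nonneg_left hd
    (fun s hs hneg => neg_nonneg.2 (h _ (hmaps hs) hneg)) (by simpa using h0) (hmaps ht)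

end Comparison

/-- A bounded globally Lipschitz autonomous vector field has a continuous flow on `[0, T]`
near any point. -/
theorem exists_flow_of_lipschitzWith_of_bounded {E : Type*} [NormedAddCommGroup E]
    [NormedSpace ℝ E] [CompleteSpace E] {f : E → E} {K L : NNReal} (hK : LipschitzWith K f)
    (hL : ∀ x, ‖f x‖ ≤ L) {T : ℝ} (hT : 0 ≤ T) (x₀ : E) (ρ : NNReal) :
    ∃ α : E × ℝ → E, (∀ x ∈ Metric.closedBall x₀ ρ, α (x, 0) = x ∧
      ∀ t ∈ Icc 0 T, HasDerivWithinAt (fun t => α (x, t)) (f (α (x, t))) (Icc 0 T) t) ∧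
      ContinuousOn α (Metric.closedBall x₀ ρ ×ˢ Icc 0 T) := by
  have hpl : IsPicardLindelof (fun _ => f) (tmin := 0) (tmax := T) ⟨0, left_mem_Icc.2 hT⟩ x₀
      (L * T.toNNReal + ρ) ρ L K :=
    .of_time_independent (fun x _ => hL x) hK.lipschitzOnWith (by simp [hT])
  exact hpl.exists_forall_mem_closedBall_eq_hasDerivWithinAt_continuousOn

/-- The vector field of the boundary value problem, with `γ` measured in units of `σ_Y ^ 2`. -/
def pubField (r : ℝ) (p : ℝ × ℝ) : ℝ × ℝ :=
  (p.1 * (r * (2 * p.1 - 1) - (1 - p.1) * p.1 * p.2), -p.2 ^ 2 * p.1 ^ 2)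

theorem exists_lipschitzOnWith_pubField (r : ℝ) {s : Set (ℝ × ℝ)} (hs : IsCompact s) :
    ∃ K, LipschitzOnWith K (pubField r) s := by
  have h : ContDiff ℝ 1 (pubField r) := by unfold pubField; fun_prop
  exact h.locallyLipschitz.locallyLipschitzOn.exists_lipschitzOnWith_of_compact hs

/-- A trajectory of `pubField` meeting the terminal condition, started at `g 0 > 0`. -/
structure PubTrajectory (r T : ℝ) (b g : ℝ → ℝ) : Prop where
  deriv_fst : ∀ t ∈ Icc 0 T, HasDerivWithinAt b (pubField r (b t, g t)).1 (Icc 0 T) t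
  deriv_snd : ∀ t ∈ Icc 0 T, HasDerivWithinAt g (pubField r (b t, g t)).2 (Icc 0 T) t
  terminal : b T = 1 / 2
  initial_pos : 0 < g 0

namespace PubTrajectory

variable {r T : ℝ} {b g b₁ g₁ b₂ g₂ : ℝ → ℝ}

theorem continuousOn_fst (h : PubTrajectory r T b g) : ContinuousOn b (Icc 0 T) :=
  fun t ht => (h.deriv_fst t ht).continuousWithinAt

theorem continuousOn_snd (h : PubTrajectory r T b g) : ContinuousOn g (Icc 0 T) :=
  fun t ht => (h.deriv_snd t ht).continuousWithinAt

theorem snd_pos (h : PubTrajectory r T b g) {t : ℝ} (ht : t ∈ Icc 0 T) : 0 < g t := by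
  have hb := h.continuousOn_fst
  have hg := h.continuousOn_snd
  refine pos_of_pos_left (a := fun t => -g t * b t ^ 2) (by fun_prop) h.deriv_snd
    (fun t _ => le_of_eq ?_) h.initial_pos ht
  simp only [pubField]
  ring

theorem fst_pos (h : PubTrajectory r T b g) {t : ℝ} (ht : t ∈ Icc 0 T) : 0 < b t := by
  have hb := h.continuousOn_fst
  have hg := h.continuousOn_snd
  refine neg_lt_zero.1 (neg_of_neg_right (y := fun t => -b t)
    (a := fun t => r * (2 * b t - 1) - (1 - b t) * b t * g t) (by fun_prop)
    (fun t ht => (h.deriv_fst t ht).fun_neg) (fun t _ => le_of_eq ?_) ?_ ht)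
  · simp only [pubField]
    ring
  · rw [h.terminal]
    norm_num

theorem fst_lt_one (hr : 0 ≤ r) (h : PubTrajectory r T b g) {t : ℝ} (ht : t ∈ Icc 0 T) :
    b t < 1 := by
  have hb := h.continuousOn_fst
  have hg := h.continuousOn_snd
  refine sub_neg.1 (neg_of_neg_right (y := fun t => b t - 1)
    (a := fun t => 2 * b t * r + b t ^ 2 * g t) (by fun_prop)
    (fun t ht => (h.deriv_fst t ht).sub_const 1) (fun t ht => ?_) ?_ ht)
  · simp only [pubField]
    linarith [mul_nonneg (h.fst_pos ht).le hr]
  · rw [h.terminal]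
    norm_num

/-- The growth rate of `b` is negative: it is so at `T`, and it can only cross zero upwards. -/
theorem growth_neg (hr : 0 ≤ r) (h : PubTrajectory r T b g) {t : ℝ} (ht : t ∈ Icc 0 T) :
    r * (2 * b t - 1) - (1 - b t) * b t * g t < 0 := by
  have hb := h.continuousOn_fst
  have hg := h.continuousOn_snd
  refine neg_of_neg_right (y := fun t => r * (2 * b t - 1) - (1 - b t) * b t * g t)
    (a := fun t => b t * (2 * r + g t * (2 * b t - 1))) (by fun_prop)
    (fun t ht => ((((h.deriv_fst t ht).const_mul 2).sub_const 1).const_mul r).fun_sub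
      ((((h.deriv_fst t ht).const_sub 1).fun_mul (h.deriv_fst t ht)).fun_mul (h.deriv_snd t ht)))
    (fun t ht => ?_) ?_ ht
  · have := mul_nonneg (mul_nonneg (sub_pos.2 (h.fst_lt_one hr ht)).le
      (pow_pos (h.fst_pos ht) 3).le) (sq_nonneg (g t))
    simp only [pubField]
    linarith
  · have := h.snd_pos (right_mem_Icc.2 (ht.1.trans ht.2))
    simp only [h.terminal]
    linarith

theorem strictAntiOn_fst (hr : 0 ≤ r) (h : PubTrajectory r T b g) : StrictAntiOn b (Icc 0 T) :=
  strictAntiOn_of_hasDerivWithinAt_neg (convex_Icc 0 T) h.continuousOn_fst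
    (fun t ht => (h.deriv_fst t (interior_subset ht)).mono interior_subset)
    fun _ ht => mul_neg_of_pos_of_neg (h.fst_pos (interior_subset ht))
      (h.growth_neg hr (interior_subset ht))

theorem strictAntiOn_snd (h : PubTrajectory r T b g) : StrictAntiOn g (Icc 0 T) :=
  strictAntiOn_of_hasDerivWithinAt_neg (convex_Icc 0 T) h.continuousOn_snd
    (fun t ht => (h.deriv_snd t (interior_subset ht)).mono interior_subset)
    fun _ ht => mul_neg_of_neg_of_pos
      (neg_lt_zero.2 (pow_pos (h.snd_pos (interior_subset ht)) 2))
      (pow_pos (h.fst_pos (interior_subset ht)) 2)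

/-- If `b₂ ≤ b₁` on an interval starting at `0` and the second components start equal, then
`g₁ ≤ g₂` there. -/
theorem snd_le_snd (h₁ : PubTrajectory r T b₁ g₁) (h₂ : PubTrajectory r T b₂ g₂)
    (h0 : g₁ 0 = g₂ 0) {u : ℝ} (huT : u ≤ T) (hle : ∀ t ∈ Icc 0 u, b₂ t ≤ b₁ t)
    {t : ℝ} (ht : t ∈ Icc 0 u) : g₁ t ≤ g₂ t := by
  have hsub : Icc 0 u ⊆ Icc 0 T := Icc_subset_Icc_right huT
  have hd : ∀ t ∈ Icc 0 u, HasDerivWithinAt (fun t => (g₁ t)⁻¹ - (g₂ t)⁻¹)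
      (b₁ t ^ 2 - b₂ t ^ 2) (Icc 0 u) t := fun t ht => by
    have hp₁ := (h₁.snd_pos (hsub ht)).ne'
    have hp₂ := (h₂.snd_pos (hsub ht)).ne'
    refine ((((h₁.deriv_snd t (hsub ht)).fun_inv hp₁).fun_sub
      ((h₂.deriv_snd t (hsub ht)).fun_inv hp₂)).mono hsub).congr_deriv ?_
    simp only [pubField]
    field_simp
  have hm : MonotoneOn (fun t => (g₁ t)⁻¹ - (g₂ t)⁻¹) (Icc 0 u) := by
    refine monotoneOn_of_hasDerivWithinAt_nonneg (convex_Icc 0 u)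
      (fun t ht => (hd t ht).continuousWithinAt)
      (fun t ht => (hd t (interior_subset ht)).mono interior_subset) fun t ht => ?_
    have ht' := interior_subset ht
    exact sub_nonneg.2 (pow_le_pow_left₀ (h₂.fst_pos (hsub ht')).le (hle t ht') 2)
  have := hm (left_mem_Icc.2 (ht.1.trans ht.2)) ht ht.1
  simp only [h0, sub_self, sub_nonneg] at this
  exact (inv_le_inv₀ (h₂.snd_pos (hsub ht)) (h₁.snd_pos (hsub ht))).1 this

/-- The system is cooperative in `(b, 1 / g)`, so trajectories with the same `g 0` and different
`b 0` cannot have the same terminal value. -/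
theorem fst_zero_le (hr : 0 ≤ r) (hT : 0 ≤ T) (h₁ : PubTrajectory r T b₁ g₁)
    (h₂ : PubTrajectory r T b₂ g₂) (h0 : g₁ 0 = g₂ 0) : b₁ 0 ≤ b₂ 0 := by
  by_contra! hlt
  have hcont : ContinuousOn (fun t => b₁ t - b₂ t) (Icc 0 T) :=
    h₁.continuousOn_fst.sub h₂.continuousOn_fst
  have hcomp : IsCompact (Icc 0 T ∩ (fun t => b₁ t - b₂ t) ⁻¹' Iic 0) :=
    isCompact_Icc.of_isClosed_subset (hcont.preimage_isClosed_of_isClosed isClosed_Icc isClosed_Iic)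
      inter_subset_left
  obtain ⟨u, ⟨hu, hbu⟩, hmin⟩ := hcomp.exists_isLeast
    ⟨T, right_mem_Icc.2 hT, by simp [h₁.terminal, h₂.terminal]⟩
  have hsub : Icc 0 u ⊆ Icc 0 T := Icc_subset_Icc_right hu.2
  have hlt' : ∀ t ∈ Ico 0 u, b₂ t < b₁ t := fun t ht => by
    by_contra! hle
    exact (hmin ⟨hsub (Ico_subset_Icc_self ht), sub_nonpos.2 hle⟩).not_gt ht.2
  have hu0 : 0 < u := hu.1.lt_of_ne fun h => by
    subst h
    exact (sub_pos.2 hlt).not_ge hbu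
  have hbu' : b₂ u ≤ b₁ u := by
    have hcl : u ∈ closure (Ico 0 u) := by
      rw [closure_Ico hu0.ne]
      exact right_mem_Icc.2 hu.1
    have hsub' := Ico_subset_Icc_self.trans hsub
    exact ContinuousWithinAt.closure_le hcl ((h₂.continuousOn_fst u hu).mono hsub')
      ((h₁.continuousOn_fst u hu).mono hsub') fun t ht => (hlt' t ht).le
  have hle : ∀ t ∈ Icc 0 u, b₂ t ≤ b₁ t := fun t ht =>
    ht.2.eq_or_lt.elim (fun h => h ▸ hbu') fun h => (hlt' t ⟨ht.1, h⟩).le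
  have hb₁ := h₁.continuousOn_fst.mono hsub
  have hb₂ := h₂.continuousOn_fst.mono hsub
  have hg₂ := h₂.continuousOn_snd.mono hsub
  refine (pos_of_pos_left (T := u) (y := fun t => b₁ t - b₂ t)
    (a := fun t => r * (2 * (b₁ t + b₂ t) - 1) - (b₁ t + b₂ t) * g₂ t
      + (b₁ t ^ 2 + b₁ t * b₂ t + b₂ t ^ 2) * g₂ t) (by fun_prop)
    (fun t ht => ((h₁.deriv_fst t (hsub ht)).fun_sub (h₂.deriv_fst t (hsub ht))).mono hsub)
    (fun t ht => ?_) (sub_pos.2 hlt) (right_mem_Icc.2 hu.1)).not_ge hbu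
  have hg := h₁.snd_le_snd h₂ h0 hu.2 hle ht
  have := mul_nonneg (mul_nonneg (sub_pos.2 (h₁.fst_lt_one hr (hsub ht))).le
    (sq_nonneg (b₁ t))) (sub_nonneg.2 hg)
  simp only [pubField]
  linarith

theorem unique (hr : 0 ≤ r) (hT : 0 ≤ T) (h₁ : PubTrajectory r T b₁ g₁)
    (h₂ : PubTrajectory r T b₂ g₂) (h0 : g₁ 0 = g₂ 0) {t : ℝ} (ht : t ∈ Icc 0 T) :
    b₁ t = b₂ t ∧ g₁ t = g₂ t := by
  have hb0 : b₁ 0 = b₂ 0 :=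
    (h₁.fst_zero_le hr hT h₂ h0).antisymm (h₂.fst_zero_le hr hT h₁ h0.symm)
  obtain ⟨K, hK⟩ := exists_lipschitzOnWith_pubField r
    ((isCompact_Icc (a := (0:ℝ)) (b := 1)).prod (isCompact_Icc (a := 0) (b := g₁ 0)))
  have hmem : ∀ {b g : ℝ → ℝ}, PubTrajectory r T b g → g 0 = g₁ 0 → ∀ t ∈ Ico 0 T,
      (b t, g t) ∈ Icc (0:ℝ) 1 ×ˢ Icc 0 (g₁ 0) := fun h hg t ht => by
    have ht := Ico_subset_Icc_self ht
    exact ⟨⟨(h.fst_pos ht).le, (h.fst_lt_one hr ht).le⟩, (h.snd_pos ht).le,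
      hg ▸ h.strictAntiOn_snd.antitoneOn (left_mem_Icc.2 hT) ht ht.1⟩
  have hder : ∀ {b g : ℝ → ℝ}, PubTrajectory r T b g → ∀ t ∈ Ico 0 T,
      HasDerivWithinAt (fun t => (b t, g t)) (pubField r (b t, g t)) (Ici t) t := fun h t ht =>
    ((h.deriv_fst t (Ico_subset_Icc_self ht)).prodMk
      (h.deriv_snd t (Ico_subset_Icc_self ht))).mono_of_mem_nhdsWithin (Icc_mem_nhdsGE_of_mem ht)
  have := ODE_solution_unique_of_mem_Icc_right (v := fun _ => pubField r) (fun _ _ => hK)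
    (h₁.continuousOn_fst.prodMk h₁.continuousOn_snd) (hder h₁) (hmem h₁ rfl)
    (h₂.continuousOn_fst.prodMk h₂.continuousOn_snd) (hder h₂) (hmem h₂ h0.symm)
    (Prod.ext hb0 h0) ht
  exact Prod.ext_iff.1 this

end PubTrajectory

/-- Clamp a point to the rectangle `[1/2, 1] × [0, m]`. -/
noncomputable def pubClamp (m : ℝ) (p : ℝ × ℝ) : ℝ × ℝ :=
  (max (1 / 2) (min 1 p.1), max 0 (min m p.2))

theorem exists_pubTrajectory {r T m : ℝ} (hr : 0 ≤ r) (hT : 0 ≤ T) (hm : 0 < m) :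
    ∃ b g : ℝ → ℝ, PubTrajectory r T b g ∧ g 0 = m := by
  have hs : IsCompact (Icc (1 / 2 : ℝ) 1 ×ˢ Icc 0 m) := isCompact_Icc.prod isCompact_Icc
  have hmaps : ∀ p, pubClamp m p ∈ Icc (1 / 2 : ℝ) 1 ×ˢ Icc 0 m := fun p =>
    ⟨⟨le_max_left _ _, max_le (by norm_num) (min_le_left _ _)⟩,
      le_max_left _ _, max_le hm.le (min_le_left _ _)⟩
  have hclamp : LipschitzWith 1 (pubClamp m) := by
    have := ((LipschitzWith.prod_fst (α := ℝ) (β := ℝ)).const_min 1).const_max (1 / 2)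
    have := this.prodMk (((LipschitzWith.prod_snd (α := ℝ) (β := ℝ)).const_min m).const_max 0)
    rwa [max_self] at this
  obtain ⟨K, hK⟩ := exists_lipschitzOnWith_pubField r hs
  have hlip : LipschitzWith K (pubField r ∘ pubClamp m) := by
    have := hK.comp (hclamp.lipschitzOnWith (s := univ)) fun p _ => hmaps p
    rwa [mul_one, lipschitzOnWith_univ] at this
  obtain ⟨C, hC⟩ := hs.exists_bound_of_continuousOn hK.continuousOn
  obtain ⟨α, hα, hαc⟩ := exists_flow_of_lipschitzWith_of_bounded hlip (L := C.toNNReal)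
    (fun p => (hC _ (hmaps p)).trans (Real.le_coe_toNNReal C)) hT (1, m) 1
  have hball : ∀ c ∈ Icc (0:ℝ) 2, ((c, m) : ℝ × ℝ) ∈ Metric.closedBall ((1, m) : ℝ × ℝ)
      ((1 : NNReal) : ℝ) := fun c hc => by
    simp only [Metric.mem_closedBall, Prod.dist_eq, dist_self, Real.dist_eq, NNReal.coe_one]
    exact max_le (abs_le.2 ⟨by linarith [hc.1], by linarith [hc.2]⟩) zero_le_one
  have hfst : ∀ c ∈ Icc (0:ℝ) 2, ∀ t ∈ Icc 0 T, HasDerivWithinAt (fun t => (α ((c, m), t)).1)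
      (pubField r (pubClamp m (α ((c, m), t)))).1 (Icc 0 T) t := fun c hc t ht =>
    ((hα _ (hball c hc)).2 t ht).fst
  have hsnd : ∀ c ∈ Icc (0:ℝ) 2, ∀ t ∈ Icc 0 T, HasDerivWithinAt (fun t => (α ((c, m), t)).2)
      (pubField r (pubClamp m (α ((c, m), t)))).2 (Icc 0 T) t := fun c hc t ht =>
    ((hα _ (hball c hc)).2 t ht).snd
  have hlow : ∀ c ∈ Icc (0:ℝ) 2, 1 / 2 ≤ (α ((c, m), T)).1 → ∀ t ∈ Icc 0 T,
      1 / 2 ≤ (α ((c, m), t)).1 := fun c hc hT' t ht => by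
    refine sub_nonneg.1 (nonneg_of_nonneg_right (y := fun t => (α ((c, m), t)).1 - 1 / 2)
      (fun t ht => (hfst c hc t ht).sub_const _) (fun t _ hneg => ?_) (sub_nonneg.2 hT') ht)
    have h1 : (pubClamp m (α ((c, m), t))).1 = 1 / 2 :=
      max_eq_left ((min_le_right _ _).trans (sub_neg.1 hneg).le)
    have h2 := (hmaps (α ((c, m), t))).2.1
    simp only [pubField, h1]
    linarith
  have hhigh : ∀ c ∈ Icc (0:ℝ) 2, (α ((c, m), T)).1 ≤ 1 → ∀ t ∈ Icc 0 T,
      (α ((c, m), t)).1 ≤ 1 := fun c hc hT' t ht => by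
    refine sub_nonneg.1 (nonneg_of_nonneg_right (y := fun t => 1 - (α ((c, m), t)).1)
      (fun t ht => (hfst c hc t ht).const_sub _) (fun t _ hneg => ?_) (sub_nonneg.2 hT') ht)
    have h1 : (pubClamp m (α ((c, m), t))).1 = 1 := by
      simp only [pubClamp, min_eq_left (sub_neg.1 hneg).le]
      norm_num
    simp only [pubField, h1]
    linarith
  have h0mem : (0:ℝ) ∈ Icc 0 T := left_mem_Icc.2 hT
  have hzero : ∀ c ∈ Icc (0:ℝ) 2, α ((c, m), 0) = (c, m) := fun c hc => (hα _ (hball c hc)).1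
  have hcont : ContinuousOn (fun c => (α ((c, m), T)).1) (Icc 0 2) :=
    (hαc.comp (f := fun c => ((c, m), T)) (by fun_prop)
      fun c hc => ⟨hball c hc, right_mem_Icc.2 hT⟩).fst
  have hl : (α ((0, m), T)).1 ≤ 1 / 2 := by
    by_contra! hlt
    have h := hlow 0 (by simp) hlt.le 0 h0mem
    rw [hzero 0 (by simp)] at h
    norm_num at h
  have hu : 1 / 2 ≤ (α ((2, m), T)).1 := by
    by_contra! hlt
    have h := hhigh 2 (by simp) (hlt.le.trans (by norm_num)) 0 h0mem
    rw [hzero 2 (by simp)] at h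
    norm_num at h
  obtain ⟨c, hc, hcT⟩ := intermediate_value_Icc zero_le_two hcont ⟨hl, hu⟩
  have hgc : (α ((c, m), 0)).2 = m := by rw [hzero c hc]
  have hg0 : ∀ t ∈ Icc 0 T, 0 ≤ (α ((c, m), t)).2 := fun t ht => by
    refine nonneg_of_nonneg_left (hsnd c hc) (fun t _ hneg => ?_) (hm.le.trans_eq hgc.symm) ht
    have h1 : (pubClamp m (α ((c, m), t))).2 = 0 :=
      max_eq_left ((min_le_right _ _).trans hneg.le)
    simp [pubField, h1]
  have hgm : ∀ t ∈ Icc 0 T, (α ((c, m), t)).2 ≤ m := fun t ht => by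
    have := antitoneOn_of_hasDerivWithinAt_nonpos (convex_Icc 0 T)
      (fun t ht => (hsnd c hc t ht).continuousWithinAt)
      (fun t ht => (hsnd c hc t (interior_subset ht)).mono interior_subset)
      (fun t _ => by
        simp only [pubField]
        nlinarith [sq_nonneg ((pubClamp m (α ((c, m), t))).1 * (pubClamp m (α ((c, m), t))).2)])
      h0mem ht ht.1
    simpa only [hgc] using this
  have hid : ∀ t ∈ Icc 0 T, pubClamp m (α ((c, m), t)) = α ((c, m), t) := fun t ht =>
    Prod.ext
      (by simp [pubClamp, min_eq_right (hhigh c hc (hcT.trans_le (by norm_num)) t ht),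
            max_eq_right (by simpa using hlow c hc hcT.ge t ht)])
      (by simp [pubClamp, min_eq_right (hgm t ht), hg0 t ht])
  refine ⟨fun t => (α ((c, m), t)).1, fun t => (α ((c, m), t)).2,
    ⟨fun t ht => ?_, fun t ht => ?_, hcT, hm.trans_eq hgc.symm⟩, hgc⟩
  · simpa only [hid t ht] using hfst c hc t ht
  · simpa only [hid t ht] using hsnd c hc t ht

theorem PubSol.pubTrajectory {r T σY γo : ℝ} {β3 γ : ℝ → ℝ} (hσY : 0 < σY) (hγo : 0 < γo)
    (h : PubSol r T σY γo β3 γ) : PubTrajectory r T β3 fun t => γ t / σY ^ 2 where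
  deriv_fst t ht := by
    refine (h.2.2.1 t ht).congr_deriv ?_
    simp only [pubField]
    ring
  deriv_snd t ht := by
    refine ((h.2.2.2.1 t ht).div_const (σY ^ 2)).congr_deriv ?_
    simp only [pubField]
    ring
  terminal := h.2.2.2.2.1
  initial_pos := by
    rw [h.2.2.2.2.2]
    positivity

theorem contDiffOn_one_Icc_of_hasDerivWithinAt {f df : ℝ → ℝ} {a b : ℝ} (hab : a < b)
    (hf : ∀ t ∈ Icc a b, HasDerivWithinAt f (df t) (Icc a b) t)
    (hf' : ContinuousOn df (Icc a b)) : ContDiffOn ℝ 1 f (Icc a b) := by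
  have hu := uniqueDiffOn_Icc hab
  refine (contDiffOn_one_iff_derivWithin hu).2 ⟨fun t ht => (hf t ht).differentiableWithinAt,
    hf'.congr fun t ht => (hf t ht).derivWithin (hu t ht)⟩

theorem PubTrajectory.pubSol {r T σY : ℝ} {b g : ℝ → ℝ} (hT : 0 < T) (hσY : 0 < σY)
    (h : PubTrajectory r T b g) : PubSol r T σY (σY ^ 2 * g 0) b fun t => σY ^ 2 * g t := by
  have hb := h.continuousOn_fst
  have hg := h.continuousOn_snd
  refine ⟨contDiffOn_one_Icc_of_hasDerivWithinAt hT h.deriv_fst ?_,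
    contDiffOn_one_Icc_of_hasDerivWithinAt hT
      (fun t ht => (h.deriv_snd t ht).const_mul (σY ^ 2)) ?_,
    fun t ht => ?_, fun t ht => ?_, h.terminal, rfl⟩
  · unfold pubField
    fun_prop
  · unfold pubField
    fun_prop
  · refine (h.deriv_fst t ht).congr_deriv ?_
    simp only [pubField]
    field_simp
  · refine ((h.deriv_snd t ht).const_mul (σY ^ 2)).congr_deriv ?_
    simp only [pubField]
    field_simp

/-- Existence, uniqueness and qualitative properties of the public-case BVP
solution (Cisternas–Kolb, Proposition 1). -/
theorem stmt_2 (r T σY γo : ℝ) (hr : 0 ≤ r) (hT : 0 < T) (hσY : 0 < σY) (hγo : 0 < γo) :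
    ∃ β3 γ : ℝ → ℝ, PubSol r T σY γo β3 γ ∧
      (∀ β3' γ' : ℝ → ℝ, PubSol r T σY γo β3' γ' →
        ∀ t ∈ Icc (0:ℝ) T, β3' t = β3 t ∧ γ' t = γ t) ∧
      (∀ t ∈ Ico (0:ℝ) T, 1/2 < β3 t ∧ β3 t < 1) ∧
      StrictAntiOn β3 (Icc 0 T) ∧
      (∀ t ∈ Icc (0:ℝ) T, 0 < γ t) ∧
      StrictAntiOn γ (Icc 0 T) := by
  obtain ⟨b, g, h, hg0⟩ := exists_pubTrajectory hr hT.le (div_pos hγo (pow_pos hσY 2))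
  have hs : 0 < σY ^ 2 := pow_pos hσY 2
  have hsol := h.pubSol hT hσY
  rw [hg0, mul_div_cancel₀ _ hs.ne'] at hsol
  refine ⟨b, fun t => σY ^ 2 * g t, hsol, fun β3' γ' h' t ht => ?_, fun t ht => ⟨?_, ?_⟩,
    h.strictAntiOn_fst hr, fun t ht => mul_pos hs (h.snd_pos ht),
    fun s hs' t ht hst => mul_lt_mul_of_pos_left (h.strictAntiOn_snd hs' ht hst) hs⟩
  · have h0 : γ' 0 / σY ^ 2 = g 0 := by rw [h'.2.2.2.2.2, hg0]
    obtain ⟨hb, hg⟩ := (h'.pubTrajectory hσY hγo).unique hr hT.le h h0 ht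
    exact ⟨hb, by simpa [mul_comm] using (div_eq_iff hs.ne').1 hg⟩
  · rw [← h.terminal]
    exact h.strictAntiOn_fst hr (Ico_subset_Icc_self ht) (right_mem_Icc.2 hT.le) ht.2
  · exact h.fst_lt_one hr (Ico_subset_Icc_self ht)
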